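/- Let f⃗ ∈ C²(Ω; ℂ³) be a vector field where Ω ⊆ ℝ³ is open, let (r,θ,ψ) with r > 0, 0 < θ < π be such that Φ(r,θ,ψ) ∈ Ω, and let F₁,F₂,F₃ denote the spherical component functions of f⃗. Then the operator Δ̃⃗[f⃗] := grad[div[f⃗]] + curl[curl[f⃗]] satisfies Δ̃⃗[f⃗](Φ(r,θ,ψ)) = {∂²F₁/∂r² + (2/r)∂F₁/∂r − (2/r²)F₁ − (1/r²)∂²F₁/∂θ² − (cot θ/r²)∂F₁/∂θ − (1/(r²sin²θ))∂²F₁/∂ψ² + (2cot θ/r)∂F₂/∂r + (2/r)∂²F₂/∂r∂θ + (2/(r sin θ))∂²F₃/∂r∂ψ}u₁ + {−∂²F₂/∂r² − (2/r)∂F₂/∂r − (1/(r²sin²θ))F₂ + (1/r²)∂²F₂/∂θ² + (cot θ/r²)∂F₂/∂θ − (1/(r²sin²θ))∂²F₂/∂ψ² + (2/r²)∂F₁/∂θ + (2/r)∂²F₁/∂r∂θ + (2/(r²sin θ))∂²F₃/∂θ∂ψ}u₂ + {−∂²F₃/∂r² − (2/r)∂F₃/∂r + (1/(r²sin²θ))F₃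 − (1/r²)∂²F₃/∂θ² − (cot θ/r²)∂F₃/∂θ + (1/(r²sin²θ))∂²F₃/∂ψ² + (2/(r²sin θ))∂F₁/∂ψ + (2/(r sin θ))∂²F₁/∂r∂ψ + (2/(r²sin θ))∂²F₂/∂θ∂ψ}u₃, all quantities evaluated at (r,θ,ψ). -/

import Mathlib

open Quaternion

noncomputable section

/-- Points of `ℝ³`. -/
abbrev P3 := Fin 3 → ℝ
/-- Vectors of `ℂ³`. -/
abbrev V3 := Fin 3 → ℂ

/-- Partial derivative `∂g/∂qᵢ` of a complex-valued function on `ℝ³`. -/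
def pd (i : Fin 3) (g : P3 → ℂ) : P3 → ℂ := fun p => fderiv ℝ g p (Pi.single i 1)

/-- Gradient of a scalar field, extended ℂ-linearly. -/
def grad (g : P3 → ℂ) : P3 → V3 := fun p => ![pd 0 g p, pd 1 g p, pd 2 g p]

/-- Divergence of a `ℂ³`-valued vector field. -/
def div3 (F : P3 → V3) : P3 → ℂ := fun p =>
  pd 0 (fun q => F q 0) p + pd 1 (fun q => F q 1) p + pd 2 (fun q => F q 2) p

/-- Curl of a `ℂ³`-valued vector field. -/
def curl (F : P3 → V3) : P3 → V3 := fun p =>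
  ![pd 1 (fun q => F q 2) p - pd 2 (fun q => F q 1) p,
    pd 2 (fun q => F q 0) p - pd 0 (fun q => F q 2) p,
    pd 0 (fun q => F q 1) p - pd 1 (fun q => F q 0) p]

/-- Scalar Laplacian `∂²/∂x² + ∂²/∂y² + ∂²/∂z²` of a complex-valued function. -/
def lap (g : P3 → ℂ) : P3 → ℂ := fun p =>
  pd 0 (pd 0 g) p + pd 1 (pd 1 g) p + pd 2 (pd 2 g) p

/-- A `ℂ³`-valued field is `Cⁿ` on a set iff each component is. -/
def VContDiffOn (n : ℕ) (F : P3 → V3) (Ω : Set P3) : Prop :=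
  ∀ i : Fin 3, ContDiffOn ℝ n (fun q => F q i) Ω

/-- A real vector of `ℝ³` viewed inside `ℂ³`. -/
def c3 (v : P3) : V3 := fun i => (v i : ℂ)

/-- Spherical coordinate map `Φ(r,θ,ψ) = (r sin θ cos ψ, r sin θ sin ψ, r cos θ)`. -/
def sphMap (p : P3) : P3 :=
  ![p 0 * Real.sin (p 1) * Real.cos (p 2),
    p 0 * Real.sin (p 1) * Real.sin (p 2),
    p 0 * Real.cos (p 1)]

/-- Spherical frame vector `u₁ = (sin θ cos ψ, sin θ sin ψ, cos θ)`, in `ℂ³`. -/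
def sphU1 (p : P3) : V3 :=
  c3 ![Real.sin (p 1) * Real.cos (p 2), Real.sin (p 1) * Real.sin (p 2), Real.cos (p 1)]

/-- Spherical frame vector `u₂ = (cos θ cos ψ, cos θ sin ψ, −sin θ)`, in `ℂ³`. -/
def sphU2 (p : P3) : V3 :=
  c3 ![Real.cos (p 1) * Real.cos (p 2), Real.cos (p 1) * Real.sin (p 2), -Real.sin (p 1)]

/-- Spherical frame vector `u₃ = (−sin ψ, cos ψ, 0)`, in `ℂ³`. -/
def sphU3 (p : P3) : V3 := c3 ![-Real.sin (p 2), Real.cos (p 2), 0]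

/-- The radius `r`, as a complex number. -/
def rC (p : P3) : ℂ := ((p 0 : ℝ) : ℂ)
/-- `sin θ`, as a complex number. -/
def sinC (p : P3) : ℂ := ((Real.sin (p 1) : ℝ) : ℂ)
/-- `cot θ`, as a complex number. -/
def cotC (p : P3) : ℂ := ((Real.cos (p 1) / Real.sin (p 1) : ℝ) : ℂ)

section PartialDerivatives

variable {i : Fin 3} {g h : P3 → ℂ} {p : P3}

lemma pd_congr (hgh : g =ᶠ[nhds p] h) : pd i g p = pd i h p := by
  rw [pd, pd, hgh.fderiv_eq]

lemma pd_eventuallyEq (hgh : g =ᶠ[nhds p] h) : pd i g =ᶠ[nhds p] pd i h :=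
  hgh.eventuallyEq_nhds.mono fun _ => pd_congr

lemma pd_const (c : ℂ) : pd i (fun _ => c) p = 0 := by simp [pd]

lemma pd_neg : pd i (fun x => -g x) p = -pd i g p := by
  simp [pd, fderiv_fun_neg]

lemma pd_add (hg : DifferentiableAt ℝ g p) (hh : DifferentiableAt ℝ h p) :
    pd i (fun x => g x + h x) p = pd i g p + pd i h p := by
  simp [pd, fderiv_fun_add hg hh]

lemma pd_sub (hg : DifferentiableAt ℝ g p) (hh : DifferentiableAt ℝ h p) :
    pd i (fun x => g x - h x) p = pd i g p - pd i h p := by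
  simp [pd, fderiv_fun_sub hg hh]

lemma pd_mul (hg : DifferentiableAt ℝ g p) (hh : DifferentiableAt ℝ h p) :
    pd i (fun x => g x * h x) p = pd i g p * h p + g p * pd i h p := by
  simp [pd, fderiv_fun_mul hg hh]
  ring

lemma pd_sum {ι : Type*} {s : Finset ι} {G : ι → P3 → ℂ}
    (hG : ∀ j ∈ s, DifferentiableAt ℝ (G j) p) :
    pd i (fun x => ∑ j ∈ s, G j x) p = ∑ j ∈ s, pd i (G j) p := by
  simp [pd, fderiv_fun_sum hG]

lemma differentiableAt_ofReal_coord {φ : ℝ → ℝ} {φ' : ℝ} {j : Fin 3}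
    (hφ : HasDerivAt φ φ' (p j)) : DifferentiableAt ℝ (fun x : P3 => (φ (x j) : ℂ)) p :=
  Complex.ofRealCLM.differentiableAt.comp p
    (hφ.differentiableAt.comp p (differentiableAt_apply j p))

lemma pd_ofReal {φ : P3 → ℝ} (hφ : DifferentiableAt ℝ φ p) :
    pd i (fun x => (φ x : ℂ)) p = (fderiv ℝ φ p (Pi.single i 1) : ℝ) := by
  have := (Complex.ofRealCLM.hasFDerivAt.comp p hφ.hasFDerivAt).fderiv
  exact congrArg (fun L => L (Pi.single i 1)) this

lemma pd_ofReal_coord {φ : ℝ → ℝ} {φ' : ℝ} {j : Fin 3} (hφ : HasDerivAt φ φ' (p j)) :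
    pd i (fun x => (φ (x j) : ℂ)) p = if j = i then (φ' : ℂ) else 0 := by
  have h := hφ.comp_hasFDerivAt p
    (ContinuousLinearMap.proj (R := ℝ) (φ := fun _ : Fin 3 => ℝ) j).hasFDerivAt
  have h' : fderiv ℝ (fun x : P3 => φ (x j)) p (Pi.single i 1) =
      φ' * Pi.single (M := fun _ => ℝ) i 1 j :=
    congrArg (fun L => L (Pi.single i 1)) h.fderiv
  rw [pd_ofReal (φ := fun x => φ (x j)) h.differentiableAt, h']
  by_cases hij : j = i <;> simp [hij]

/-- The chain rule in coordinates. -/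
lemma pd_comp {φ : P3 → P3} (hg : DifferentiableAt ℝ g (φ p)) (hφ : DifferentiableAt ℝ φ p) :
    pd i (fun x => g (φ x)) p = ∑ k, pd i (fun x => (φ x k : ℂ)) p * pd k g (φ p) := by
  have key : pd i (fun x => g (φ x)) p = fderiv ℝ g (φ p) (fderiv ℝ φ p (Pi.single i 1)) :=
    congrArg (fun L => L (Pi.single i 1)) (fderiv_comp p hg hφ)
  rw [key, pi_eq_sum_univ' (fderiv ℝ φ p (Pi.single i 1)), map_sum]
  refine Finset.sum_congr rfl fun k _ => ?_
  have hk : fderiv ℝ (fun x => φ x k) p (Pi.single i 1) = fderiv ℝ φ p (Pi.single i 1) k :=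
    congrArg (fun L => L (Pi.single i 1)) (hasFDerivAt_pi'.1 hφ.hasFDerivAt k).fderiv
  rw [pd_ofReal (differentiableAt_pi.1 hφ k), hk]
  simp [pd]

lemma ContDiffAt.pd {n : ℕ} (hg : ContDiffAt ℝ (n + 1 : ℕ) g p) : ContDiffAt ℝ n (pd i g) p :=
  (hg.fderiv_right (m := n) (by norm_cast)).clm_apply contDiffAt_const

lemma pd_pd_comm {j : Fin 3} (hg : ContDiffAt ℝ 2 g p) : pd i (pd j g) p = pd j (pd i g) p := by
  have hd : DifferentiableAt ℝ (fderiv ℝ g) p :=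
    (hg.fderiv_right (m := 1) (by norm_num)).differentiableAt (by norm_num)
  have key (a b : Fin 3) :
      pd a (pd b g) p = fderiv ℝ (fderiv ℝ g) p (Pi.single a 1) (Pi.single b 1) := by
    have : fderiv ℝ (pd b g) p = _ :=
      (hd.hasFDerivAt.clm_apply (hasFDerivAt_const (Pi.single b (1 : ℝ) : P3) p)).fderiv
    rw [pd, this]
    simp
  rw [key, key]
  exact (hg.isSymmSndFDerivAt (by simp)).eq _ _

end PartialDerivatives

/-- `cos θ`, as a complex number. -/
def cosC (p : P3) : ℂ := ((Real.cos (p 1) : ℝ) : ℂ)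

/-- The spherical frame `u₁, u₂, u₃`. -/
def frame (a : Fin 3) (p : P3) : V3 := ![sphU1 p, sphU2 p, sphU3 p] a

/-- The scale factors `1, r, r sin θ` of the spherical coordinates. -/
def scale (i : Fin 3) (p : P3) : ℂ := ![1, rC p, rC p * sinC p] i

/-- The connection coefficients of the spherical frame: `∂ᵢ u_a = ∑ b, conn i a b • u_b`. -/
def conn (i a b : Fin 3) (p : P3) : ℂ :=
  ![!![0, 0, 0; 0, 0, 0; 0, 0, 0],
    !![0, 1, 0; -1, 0, 0; 0, 0, 0],
    !![0, 0, sinC p; 0, 0, cosC p; -sinC p, -cosC p, 0]] i a b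

section Frame

variable {p : P3}

lemma differentiableAt_rC : DifferentiableAt ℝ rC p :=
  differentiableAt_ofReal_coord (hasDerivAt_id _)

lemma differentiableAt_sin (j : Fin 3) :
    DifferentiableAt ℝ (fun x : P3 => (Real.sin (x j) : ℂ)) p :=
  differentiableAt_ofReal_coord (Real.hasDerivAt_sin _)

lemma differentiableAt_cos (j : Fin 3) :
    DifferentiableAt ℝ (fun x : P3 => (Real.cos (x j) : ℂ)) p :=
  differentiableAt_ofReal_coord (Real.hasDerivAt_cos _)

lemma differentiableAt_sinC : DifferentiableAt ℝ sinC p := differentiableAt_sin 1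

lemma differentiableAt_cosC : DifferentiableAt ℝ cosC p := differentiableAt_cos 1

lemma pd_sin (i j : Fin 3) :
    pd i (fun x => (Real.sin (x j) : ℂ)) p = if j = i then (Real.cos (p j) : ℂ) else 0 :=
  pd_ofReal_coord (Real.hasDerivAt_sin _)

lemma pd_cos (i j : Fin 3) :
    pd i (fun x => (Real.cos (x j) : ℂ)) p = if j = i then -(Real.sin (p j) : ℂ) else 0 := by
  rw [pd_ofReal_coord (Real.hasDerivAt_cos _), Complex.ofReal_neg]

lemma pd_rC (i : Fin 3) : pd i rC p = if 0 = i then 1 else 0 := by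
  have := pd_ofReal_coord (i := i) (hasDerivAt_id (p 0))
  rwa [Complex.ofReal_one] at this

lemma pd_sinC (i : Fin 3) : pd i sinC p = if 1 = i then cosC p else 0 := pd_sin i 1

lemma pd_cosC (i : Fin 3) : pd i cosC p = if 1 = i then -sinC p else 0 := pd_cos i 1

lemma sin_sq_add_cos_sq_ofReal (t : ℝ) : (Real.sin t : ℂ) ^ 2 + (Real.cos t : ℂ) ^ 2 = 1 :=
  mod_cast Real.sin_sq_add_cos_sq t

lemma differentiableAt_frame (a m : Fin 3) : DifferentiableAt ℝ (fun x => frame a x m) p := by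
  have hs := differentiableAt_sin (p := p)
  have hc := differentiableAt_cos (p := p)
  fin_cases a <;> fin_cases m <;>
    simp [frame, sphU1, sphU2, sphU3, c3, -Complex.ofReal_sin, -Complex.ofReal_cos, hs, hc,
      DifferentiableAt.fun_mul]

lemma pd_frame (i a m : Fin 3) :
    pd i (fun x => frame a x m) p = ∑ b, conn i a b p * frame b p m := by
  have hs := differentiableAt_sin (p := p)
  have hc := differentiableAt_cos (p := p)
  fin_cases i <;> fin_cases a <;> fin_cases m <;>
    simp [Fin.sum_univ_three, frame, conn, sphU1, sphU2, sphU3, c3, sinC, cosC,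
      -Complex.ofReal_sin, -Complex.ofReal_cos, pd_mul, pd_neg, pd_const, pd_sin, pd_cos, hs, hc]
  · linear_combination (Real.cos (p 2) : ℂ) * sin_sq_add_cos_sq_ofReal (p 1)
  · linear_combination (Real.sin (p 2) : ℂ) * sin_sq_add_cos_sq_ofReal (p 1)
  · ring

lemma frame_orthonormal (p : P3) (m n : Fin 3) :
    ∑ a, frame a p m * frame a p n = if m = n then 1 else 0 := by
  have h₁ := sin_sq_add_cos_sq_ofReal (p 1)
  have h₂ := sin_sq_add_cos_sq_ofReal (p 2)
  fin_cases m <;> fin_cases n <;>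
    simp [Fin.sum_univ_three, frame, sphU1, sphU2, sphU3, c3, -Complex.ofReal_sin,
      -Complex.ofReal_cos] <;>
    grind

lemma sum_frame_mul_frame (p : P3) (a b : Fin 3) :
    ∑ m, frame a p m * frame b p m = if a = b then 1 else 0 := by
  have h₁ := sin_sq_add_cos_sq_ofReal (p 1)
  have h₂ := sin_sq_add_cos_sq_ofReal (p 2)
  fin_cases a <;> fin_cases b <;>
    simp [Fin.sum_univ_three, frame, sphU1, sphU2, sphU3, c3, -Complex.ofReal_sin,
      -Complex.ofReal_cos] <;>
    grind

lemma differentiable_sphMap : Differentiable ℝ sphMap := by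
  refine differentiable_pi.2 fun k => ?_
  fin_cases k <;> simp [sphMap] <;> fun_prop

lemma pd_sphMap (i k : Fin 3) :
    pd i (fun x => (sphMap x k : ℂ)) p = scale i p * frame i p k := by
  have hs := differentiableAt_sin (p := p)
  have hc := differentiableAt_cos (p := p)
  have hr : DifferentiableAt ℝ (fun x : P3 => (x 0 : ℂ)) p := differentiableAt_rC
  have hr' : ∀ i, pd i (fun x : P3 => (x 0 : ℂ)) p = if 0 = i then 1 else 0 := pd_rC
  fin_cases i <;> fin_cases k <;>
    simp [sphMap, frame, scale, sphU1, sphU2, sphU3, c3, sinC, rC, -Complex.ofReal_sin,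
      -Complex.ofReal_cos, pd_mul, pd_sin, pd_cos, hs, hc, hr, hr', DifferentiableAt.fun_mul] <;>
    ring

lemma differentiableAt_scale (i : Fin 3) : DifferentiableAt ℝ (scale i) p := by
  fin_cases i
  · exact differentiableAt_const (1 : ℂ)
  · exact differentiableAt_rC
  · exact differentiableAt_rC.mul differentiableAt_sinC

lemma pd_scale (c i : Fin 3) :
    pd c (scale i) p =
      !![0, 1, sinC p; 0, 0, rC p * cosC p; 0, 0, 0] c i := by
  have h₀ : scale 0 = fun _ => 1 := rfl
  have h₁ : scale 1 = rC := rfl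
  have h₂ : scale 2 = fun x => rC x * sinC x := rfl
  fin_cases c <;> fin_cases i <;>
    simp [h₀, h₁, h₂, pd_const, pd_rC, pd_sinC, pd_mul, differentiableAt_rC,
      differentiableAt_sinC]

lemma differentiableAt_conn (i a b : Fin 3) : DifferentiableAt ℝ (conn i a b) p := by
  have hs := differentiableAt_sinC (p := p)
  have hc := differentiableAt_cosC (p := p)
  unfold conn
  fin_cases i <;> fin_cases a <;> fin_cases b <;> simp [hs, hc]

lemma pd_conn (c i a b : Fin 3) :
    pd c (conn i a b) p =
      if c = 1 ∧ i = 2 then !![0, 0, cosC p; 0, 0, -sinC p; -cosC p, sinC p, 0] a b else 0 := by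
  unfold conn
  fin_cases c <;> fin_cases i <;> fin_cases a <;> fin_cases b <;>
    simp [pd_const, pd_neg, pd_sinC, pd_cosC]

/-- The partial derivatives of a pulled back function are the scaled frame derivatives. -/
lemma pd_comp_sphMap {g : P3 → ℂ} (hg : DifferentiableAt ℝ g (sphMap p)) (i : Fin 3) :
    pd i (fun x => g (sphMap x)) p = scale i p * ∑ k, frame i p k * pd k g (sphMap p) := by
  rw [pd_comp hg (differentiable_sphMap p), Finset.mul_sum]
  exact Finset.sum_congr rfl fun k _ => by rw [pd_sphMap, mul_assoc]

end Frame

/-- The component of the field `w` along `u_a`, in spherical coordinates. -/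
def frameComp (w : P3 → V3) (a : Fin 3) (p : P3) : ℂ := ∑ m, frame a p m * w (sphMap p) m

/-- The component along `u_a` of the first derivative of `w` in direction `u_c`. -/
def frameComp₁ (w : P3 → V3) (a c : Fin 3) (p : P3) : ℂ :=
  ∑ m, ∑ k, frame a p m * frame c p k * pd k (fun x => w x m) (sphMap p)

/-- The component along `u_a` of the second derivative of `w` in directions `u_c` and `u_i`. -/
def frameComp₂ (w : P3 → V3) (a c i : Fin 3) (p : P3) : ℂ :=
  ∑ m, ∑ k, ∑ l, frame a p m * frame c p k * frame i p l *
    pd l (pd k fun x => w x m) (sphMap p)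

section FrameComp

variable {w : P3 → V3} {p : P3}

lemma differentiableAt_frameComp
    (hw : ∀ m, DifferentiableAt ℝ (fun x => w x m) (sphMap p)) (a : Fin 3) :
    DifferentiableAt ℝ (frameComp w a) p :=
  .fun_sum fun m _ => (differentiableAt_frame a m).mul
    ((hw m).comp p (differentiable_sphMap p))

lemma pd_frameComp (hw : ∀ m, DifferentiableAt ℝ (fun x => w x m) (sphMap p)) (i a : Fin 3) :
    pd i (frameComp w a) p =
      scale i p * frameComp₁ w a i p + ∑ b, conn i a b p * frameComp w b p := by
  have hc m : DifferentiableAt ℝ (fun x => w (sphMap x) m) p :=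
    (hw m).comp p (differentiable_sphMap p)
  have hd m := pd_comp_sphMap (hw m) i
  unfold frameComp frameComp₁
  rw [pd_sum fun m _ => (differentiableAt_frame a m).fun_mul (hc m)]
  simp only [pd_mul (differentiableAt_frame a _) (hc _), hd, pd_frame]
  simp only [Fin.sum_univ_three]
  ring

lemma differentiableAt_frameComp₁
    (hw : ∀ m k, DifferentiableAt ℝ (pd k fun x => w x m) (sphMap p)) (a c : Fin 3) :
    DifferentiableAt ℝ (frameComp₁ w a c) p :=
  .fun_sum fun m _ => .fun_sum fun k _ =>
    ((differentiableAt_frame a m).mul (differentiableAt_frame c k)).mul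
      ((hw m k).comp p (differentiable_sphMap p))

lemma pd_frameComp₁ (hw : ∀ m k, DifferentiableAt ℝ (pd k fun x => w x m) (sphMap p))
    (i a c : Fin 3) :
    pd i (frameComp₁ w a c) p =
      scale i p * frameComp₂ w a c i p + ∑ b, conn i a b p * frameComp₁ w b c p +
        ∑ b, conn i c b p * frameComp₁ w a b p := by
  have hc m k : DifferentiableAt ℝ (fun x => pd k (fun x => w x m) (sphMap x)) p :=
    (hw m k).comp p (differentiable_sphMap p)
  have hd m k := pd_comp_sphMap (hw m k) i
  have hf m k := (differentiableAt_frame (p := p) a m).fun_mul (differentiableAt_frame c k)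
  have hp m k := (hf m k).fun_mul (hc m k)
  unfold frameComp₁ frameComp₂
  rw [pd_sum fun m _ => .fun_sum fun k _ => hp m k]
  simp only [pd_sum fun k _ => hp _ k, pd_mul (hf _ _) (hc _ _),
    pd_mul (differentiableAt_frame a _) (differentiableAt_frame c _), hd, pd_frame]
  simp only [Fin.sum_univ_three]
  ring

lemma pd_pd_frameComp
    (hw : ∀ᶠ x in nhds p, ∀ m, DifferentiableAt ℝ (fun y => w y m) (sphMap x))
    (hw' : ∀ m k, DifferentiableAt ℝ (pd k fun x => w x m) (sphMap p)) (c i a : Fin 3) :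
    pd c (pd i (frameComp w a)) p =
      pd c (scale i) p * frameComp₁ w a i p + scale i p * pd c (frameComp₁ w a i) p +
        ∑ b, (pd c (conn i a b) p * frameComp w b p + conn i a b p * pd c (frameComp w b) p) := by
  have h₀ := differentiableAt_frameComp hw.self_of_nhds
  have h₁ := differentiableAt_frameComp₁ hw' a i
  have hb b := (differentiableAt_conn (p := p) i a b).fun_mul (h₀ b)
  rw [pd_congr (hw.mono fun x hx => pd_frameComp hx i a),
    pd_add ((differentiableAt_scale i).fun_mul h₁) (.fun_sum fun b _ => hb b),
    pd_mul (differentiableAt_scale i) h₁, pd_sum fun b _ => hb b]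
  simp only [pd_mul (differentiableAt_conn i a _) (h₀ _)]

/-- Contracting two frame indices amounts to contracting two Cartesian indices. -/
lemma sum_frame_mul_frameComp₂ (m : Fin 3) :
    ∑ a, frame a p m * ∑ b, (2 * frameComp₂ w b a b p - frameComp₂ w a b b p) =
      ∑ k, (2 * pd k (pd m fun x => w x k) (sphMap p) -
        pd k (pd k fun x => w x m) (sphMap p)) := by
  let H (n k l : Fin 3) : ℂ := pd l (pd k fun x => w x n) (sphMap p)
  have hdiv : ∑ a, frame a p m * ∑ b, frameComp₂ w b a b p = ∑ n, ∑ k, ∑ l,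
      (∑ a, frame a p m * frame a p k) * (∑ b, frame b p n * frame b p l) * H n k l := by
    simp only [frameComp₂, Fin.sum_univ_three, H]
    ring
  have hlap : ∑ a, frame a p m * ∑ b, frameComp₂ w a b b p = ∑ n, ∑ k, ∑ l,
      (∑ a, frame a p m * frame a p n) * (∑ b, frame b p k * frame b p l) * H n k l := by
    simp only [frameComp₂, Fin.sum_univ_three, H]
    ring
  simp only [Finset.sum_sub_distrib, ← Finset.mul_sum, mul_sub, mul_left_comm _ (2 : ℂ),
    hdiv, hlap, frame_orthonormal]
  simp [H, ite_mul, Finset.sum_ite_eq]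

lemma frameComp₂_comm (hw : ∀ m, ContDiffAt ℝ 2 (fun y => w y m) (sphMap p)) (a c i : Fin 3) :
    frameComp₂ w a c i p = frameComp₂ w a i c p := by
  refine Finset.sum_congr rfl fun m _ => Finset.sum_comm.trans ?_
  simp only [pd_pd_comm (hw m), mul_right_comm]

lemma frameComp_eq {F : Fin 3 → P3 → ℂ} (h : w (sphMap p) = ∑ a, F a p • frame a p)
    (a : Fin 3) : F a p = frameComp w a p := by
  have key : frameComp w a p = ∑ b, F b p * ∑ m, frame a p m * frame b p m := by
    simp only [frameComp, h, Fin.sum_univ_three, Pi.add_apply, Pi.smul_apply, smul_eq_mul]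
    ring
  simp [key, sum_frame_mul_frame]

/-- In Cartesian coordinates, `grad (div w) + curl (curl w) = 2 grad (div w) - Δ w`. -/
lemma grad_div3_add_curl_curl {x : P3} (hw : ∀ m, ContDiffAt ℝ 2 (fun y => w y m) x)
    (m : Fin 3) :
    (grad (div3 w) x + curl (curl w) x) m =
      ∑ k, (2 * pd k (pd m fun x => w x k) x - pd k (pd k fun x => w x m) x) := by
  have hd j k : DifferentiableAt ℝ (pd k fun x => w x j) x :=
    (ContDiffAt.pd (n := 1) (by exact_mod_cast hw j)).differentiableAt (by norm_num)
  have hdiv i : pd i (div3 w) x = ∑ k, pd i (pd k fun y => w y k) x := by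
    unfold div3
    rw [pd_add ((hd _ _).fun_add (hd _ _)) (hd _ _), pd_add (hd _ _) (hd _ _),
      Fin.sum_univ_three]
  fin_cases m <;>
    simp [grad, curl, hdiv, Fin.sum_univ_three, pd_sub, hd,
      pd_pd_comm (i := 1) (j := 0) (hw _), pd_pd_comm (i := 2) (j := 0) (hw _),
      pd_pd_comm (i := 2) (j := 1) (hw _)] <;>
    ring

end FrameComp

/-- For a vector field `f⃗ ∈ C²(Ω; ℂ³)` with spherical component
functions `F₁, F₂, F₃` (so `f⃗∘Φ = F₁u₁ + F₂u₂ + F₃u₃` wherever `Φ(r,θ,ψ) ∈ Ω`),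
and any `(r,θ,ψ)` with `r > 0`, `0 < θ < π` and `Φ(r,θ,ψ) ∈ Ω`, the operator
`Δ̃⃗[f⃗] = grad[div[f⃗]] + curl[curl[f⃗]]` (the vector part of the generalization of the
Bitsadze operator to `ℝ³`) at `Φ(r,θ,ψ)` is given by the classical spherical
expression. -/
theorem bitsadze_spherical (Ω : Set P3) (hΩ : IsOpen Ω) (fv : P3 → V3)
    (hfv : VContDiffOn 2 fv Ω) (F₁ F₂ F₃ : P3 → ℂ)
    (hdec : ∀ p : P3, sphMap p ∈ Ω →
      fv (sphMap p) = F₁ p • sphU1 p + F₂ p • sphU2 p + F₃ p • sphU3 p)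
    (q : P3) (hr : 0 < q 0) (hθ₀ : 0 < q 1) (hθπ : q 1 < Real.pi)
    (hq : sphMap q ∈ Ω) :
    grad (div3 fv) (sphMap q) + curl (curl fv) (sphMap q) =
      (pd 0 (pd 0 F₁) q + (2 / rC q) * pd 0 F₁ q - (2 / rC q ^ 2) * F₁ q -
        (1 / rC q ^ 2) * pd 1 (pd 1 F₁) q - (cotC q / rC q ^ 2) * pd 1 F₁ q -
        (1 / (rC q ^ 2 * sinC q ^ 2)) * pd 2 (pd 2 F₁) q +
        (2 * cotC q / rC q) * pd 0 F₂ q + (2 / rC q) * pd 0 (pd 1 F₂) q +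
        (2 / (rC q * sinC q)) * pd 0 (pd 2 F₃) q) • sphU1 q +
      (-pd 0 (pd 0 F₂) q - (2 / rC q) * pd 0 F₂ q -
        (1 / (rC q ^ 2 * sinC q ^ 2)) * F₂ q +
        (1 / rC q ^ 2) * pd 1 (pd 1 F₂) q + (cotC q / rC q ^ 2) * pd 1 F₂ q -
        (1 / (rC q ^ 2 * sinC q ^ 2)) * pd 2 (pd 2 F₂) q +
        (2 / rC q ^ 2) * pd 1 F₁ q + (2 / rC q) * pd 0 (pd 1 F₁) q +
        (2 / (rC q ^ 2 * sinC q)) * pd 1 (pd 2 F₃) q) • sphU2 q +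
      (-pd 0 (pd 0 F₃) q - (2 / rC q) * pd 0 F₃ q +
        (1 / (rC q ^ 2 * sinC q ^ 2)) * F₃ q -
        (1 / rC q ^ 2) * pd 1 (pd 1 F₃) q - (cotC q / rC q ^ 2) * pd 1 F₃ q +
        (1 / (rC q ^ 2 * sinC q ^ 2)) * pd 2 (pd 2 F₃) q +
        (2 / (rC q ^ 2 * sinC q)) * pd 2 F₁ q +
        (2 / (rC q * sinC q)) * pd 0 (pd 2 F₁) q +
        (2 / (rC q ^ 2 * sinC q)) * pd 1 (pd 2 F₂) q) • sphU3 q := by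
  have hcont {x : P3} (hx : sphMap x ∈ Ω) (m : Fin 3) :
      ContDiffAt ℝ 2 (fun y => fv y m) (sphMap x) :=
    (hfv m).contDiffAt (hΩ.mem_nhds hx)
  have hmem : ∀ᶠ x in nhds q, sphMap x ∈ Ω :=
    differentiable_sphMap.continuous.continuousAt.eventually (hΩ.mem_nhds hq)
  have hd : ∀ᶠ x in nhds q, ∀ m, DifferentiableAt ℝ (fun y => fv y m) (sphMap x) :=
    hmem.mono fun x hx m => (hcont hx m).differentiableAt (by norm_num)
  have hd' (m k : Fin 3) : DifferentiableAt ℝ (pd k fun y => fv y m) (sphMap q) :=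
    (ContDiffAt.pd (n := 1) (by exact_mod_cast hcont hq m)).differentiableAt (by norm_num)
  have hF (a : Fin 3) : ![F₁, F₂, F₃] a =ᶠ[nhds q] frameComp fv a :=
    hmem.mono fun x hx => frameComp_eq (by simpa [Fin.sum_univ_three, frame] using hdec x hx) a
  have h₁ : F₁ =ᶠ[nhds q] frameComp fv 0 := hF 0
  have h₂ : F₂ =ᶠ[nhds q] frameComp fv 1 := hF 1
  have h₃ : F₃ =ᶠ[nhds q] frameComp fv 2 := hF 2
  have hr₀ : rC q ≠ 0 := Complex.ofReal_ne_zero.2 hr.ne'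
  have hs₀ : sinC q ≠ 0 := Complex.ofReal_ne_zero.2 (Real.sin_pos_of_pos_of_lt_pi hθ₀ hθπ).ne'
  have hcot : cotC q = cosC q / sinC q := Complex.ofReal_div _ _
  have hsc : sinC q ^ 2 + cosC q ^ 2 = 1 := sin_sq_add_cos_sq_ofReal _
  have hsymm := frameComp₂_comm (hcont hq)
  ext m
  rw [grad_div3_add_curl_curl (hcont hq), ← sum_frame_mul_frameComp₂, Fin.sum_univ_three]
  simp only [Pi.add_apply, Pi.smul_apply, smul_eq_mul]
  rw [mul_comm (frame 0 q m), mul_comm (frame 1 q m), mul_comm (frame 2 q m)]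
  simp only [pd_congr h₁, pd_congr h₂, pd_congr h₃, h₁.self_of_nhds, h₂.self_of_nhds,
    h₃.self_of_nhds, pd_congr (pd_eventuallyEq h₁), pd_congr (pd_eventuallyEq h₂),
    pd_congr (pd_eventuallyEq h₃), pd_pd_frameComp hd hd', pd_frameComp hd.self_of_nhds,
    pd_frameComp₁ hd', pd_scale, pd_conn, hcot]
  congr 1
  · congr 1
    · refine congrArg (· * sphU1 q m) ?_
      simp [Fin.sum_univ_three, scale, conn]
      field_simp
      simp only [hsymm 1 1 0, hsymm 2 2 0]
      ring
    · refine congrArg (· * sphU2 q m) ?_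
      simp [Fin.sum_univ_three, scale, conn]
      field_simp
      simp only [hsymm 0 1 0, hsymm 2 2 1]
      linear_combination -frameComp fv 1 q * hsc
  · refine congrArg (· * sphU3 q m) ?_
    simp [Fin.sum_univ_three, scale, conn]
    field_simp
    simp only [hsymm 0 2 0, hsymm 1 2 1]
    linear_combination frameComp fv 2 q * hsc
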